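/- arXiv:1604.07665 — 4 statements merged into one kernel-verified Lean document; each statement's English description precedes it below -/
import Mathlib

section
/- Over GF(2^3) generated by a root ω of ω³ + ω + 1, there exist exactly 84 superregular 5×5 lower triangular Toeplitz matrices of the form with first column [1, ω^{i_1}, ω^{i_2}, ω^{i_3}, ω^{i_4}]^T with i_j ∈ {0,...,6}. -/
open Matrix

/-- Lower triangular Toeplitz matrix with first column `c`. -/
def LTT {R : Type*} [CommRing R] {n : ℕ} (c : Fin n → R) : Matrix (Fin n) (Fin n) R :=
  Matrix.of fun j k =>
    if (k : ℕ) ≤ (j : ℕ) then c ⟨(j : ℕ) - (k : ℕ), lt_of_le_of_lt (Nat.sub_le _ _) j.isLt⟩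
    else 0

/-- A lower triangular matrix is superregular if every proper submatrix
(rows `j₁ < ... < j_r`, columns `h₁ < ... < h_r` with `h_t ≤ j_t`) is nonsingular. -/
def Superregular {F : Type*} [Field F] {n : ℕ} (A : Matrix (Fin n) (Fin n) F) : Prop :=
  ∀ (r : ℕ) (row col : Fin r → Fin n), StrictMono row → StrictMono col →
    (∀ t, col t ≤ row t) → (A.submatrix row col).det ≠ 0

/-- Two `n × n` lower triangular matrices are jointly superregular if every
proper (not trivially rank deficient) square submatrix of any matrix formed by
mixing rows of `A` and rows of `B` is nonsingular.  Rows are selected sorted by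
their index (i.e. by increasing support), a row index may be used by both `A`
and `B`, and properness means `col t ≤ row t` for all `t`. -/
def JointlySuperregular {F : Type*} [Field F] {n : ℕ}
    (A B : Matrix (Fin n) (Fin n) F) : Prop :=
  ∀ (r : ℕ) (row : Fin r → Fin n) (tag : Fin r → Bool) (col : Fin r → Fin n),
    Monotone row → Function.Injective (fun t => (row t, tag t)) → StrictMono col →
    (∀ t, col t ≤ row t) →
    (Matrix.of fun t s => (if tag t then A else B) (row t) (col s)).det ≠ 0

namespace GF8

/-- Multiplication of 3-bit codes of elements of `𝔽₂[X]/(X³ + X + 1)`, read off from the packed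
multiplication table whose entry at `8 a + b` occupies three bits. -/
def mul (a b : ℕ) : ℕ :=
  2821848294356612419217921029917578219971947684264937521152 >>> (3 * (8 * (a % 8) + b % 8))

/-- The code of the `n`-th power of the generator, for `n < 7`. -/
def genPow (n : ℕ) : ℕ := 1566481 >>> (3 * n)

/-- All ways of removing one element from a list, paired with the removed element. -/
def picks {α : Type*} : List α → List (α × List α)
  | [] => []
  | c :: C => (c, C) :: (picks C).map fun p => (p.1, c :: p.2)

/-- Code of the minor of `A` on the given rows and columns, by Laplace expansion. -/
def minor {α β : Type*} (A : α → β → ℕ) : List α → List β → ℕ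
  | [], _ => 1
  | i :: R, C => (picks C).foldr (fun p s => mul (A i p.1) (minor A R p.2) ^^^ s) 0

theorem picks_ofFn {α : Type*} {n : ℕ} (f : Fin (n + 1) → α) :
    picks (List.ofFn f) =
      List.ofFn fun j => (f j, List.ofFn fun k => f (j.succAbove k)) := by
  induction n with
  | zero => simp [picks]
  | succ n ih =>
    rw [List.ofFn_succ, picks, ih, List.ofFn_succ (f := fun j => (f j, _))]
    simp only [List.map_ofFn, Fin.zero_succAbove, List.cons.injEq, true_and]
    congr 1
    funext j
    simp [List.ofFn_succ]

section Eval

variable {F : Type*} [Field F]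

/-- The field element with a given code. -/
def eval (ω : F) (n : ℕ) : F :=
  (if n.testBit 0 then 1 else 0) + (if n.testBit 1 then ω else 0) +
    (if n.testBit 2 then ω ^ 2 else 0)

theorem eval_zero (ω : F) : eval ω 0 = 0 := by simp [eval]

theorem eval_one (ω : F) : eval ω 1 = 1 := by simp [eval, Nat.testBit]

theorem eval_mod (ω : F) (n : ℕ) : eval ω (n % 8) = eval ω n := by
  simp [eval, show 8 = 2 ^ 3 by norm_num, Nat.testBit_mod_two_pow, -Nat.reducePow]

variable [CharP F 2] {ω : F}

theorem eval_xor (ω : F) (m n : ℕ) : eval ω (m ^^^ n) = eval ω m + eval ω n := by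
  have h (x : F) (a b : Bool) : (if (a ^^ b) = true then x else 0) =
      (if a = true then x else 0) + (if b = true then x else 0) := by
    cases a <;> cases b <;> simp [CharTwo.add_self_eq_zero]
  simp only [eval, Nat.testBit_xor, h]
  ring

theorem eval_mul (hω : ω ^ 3 + ω + 1 = 0) (a b : ℕ) :
    eval ω (mul a b) = eval ω a * eval ω b := by
  have h2 : (2 : F) = 0 := CharTwo.two_eq_zero
  have key : ∀ a < 8, ∀ b < 8, eval ω (mul a b) = eval ω a * eval ω b := by
    intro a ha b hb
    interval_cases a <;> interval_cases b <;>
      simp [eval, mul, Nat.testBit, Nat.shiftRight_eq_div_pow] <;> grind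
  rw [← eval_mod ω a, ← eval_mod ω b,
    ← key _ (Nat.mod_lt _ (by norm_num)) _ (Nat.mod_lt _ (by norm_num))]
  simp [mul]

theorem eval_genPow (hω : ω ^ 3 + ω + 1 = 0) (n : Fin 7) : eval ω (genPow n) = ω ^ (n : ℕ) := by
  have h2 : (2 : F) = 0 := CharTwo.two_eq_zero
  fin_cases n <;>
    simp [eval, genPow, Nat.testBit, Nat.shiftRight_eq_div_pow] <;> grind

theorem eval_eq_zero_iff (hω : ω ^ 3 + ω + 1 = 0) (n : ℕ) : eval ω n = 0 ↔ n % 8 = 0 := by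
  have h2 : (2 : F) = 0 := CharTwo.two_eq_zero
  rw [← eval_mod]
  have := Nat.mod_lt n (show 0 < 8 by norm_num)
  generalize n % 8 = m at *
  interval_cases m <;> simp [eval, Nat.testBit] <;> grind

theorem eval_minor (hω : ω ^ 3 + ω + 1 = 0) {α β : Type*} (A : α → β → ℕ) {n : ℕ}
    (row : Fin n → α) (col : Fin n → β) :
    eval ω (minor A (List.ofFn row) (List.ofFn col)) =
      (Matrix.of fun i j => eval ω (A (row i) (col j))).det := by
  induction n with
  | zero => simpa [minor] using eval_one ω
  | succ n ih =>
    have hsum (i : α) (R : List α) (l : List (β × List β)) :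
        eval ω (l.foldr (fun p s => mul (A i p.1) (minor A R p.2) ^^^ s) 0) =
          (l.map fun p => eval ω (A i p.1) * eval ω (minor A R p.2)).sum := by
      induction l with
      | nil => simpa using eval_zero ω
      | cons p l ihl => simp [eval_xor, eval_mul hω, ihl]
    rw [Matrix.det_succ_row_zero, List.ofFn_succ, minor, hsum, picks_ofFn, List.map_ofFn,
      List.sum_ofFn]
    refine Finset.sum_congr rfl fun j _ => ?_
    simp only [Function.comp_apply, ih, CharTwo.neg_eq, one_pow, one_mul]
    rfl

end Eval

/-- Codes of the entries of the lower triangular Toeplitz matrix with first column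
`1, ω ^ e₀, ω ^ e₁, ω ^ e₂, ω ^ e₃`. -/
def toeplitzEntry (e : Fin 7 × Fin 7 × Fin 7 × Fin 7) (j k : ℕ) : ℕ :=
  if k ≤ j then
    match j - k with
    | 0 => 1
    | 1 => genPow e.1
    | 2 => genPow e.2.1
    | 3 => genPow e.2.2.1
    | _ => genPow e.2.2.2
  else 0

theorem eval_toeplitzEntry {F : Type*} [Field F] [CharP F 2] {ω : F}
    (hω : ω ^ 3 + ω + 1 = 0) (e : Fin 7 × Fin 7 × Fin 7 × Fin 7) (j k : Fin 5) :
    eval ω (toeplitzEntry e j k) =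
      LTT ![(1 : F), ω ^ (e.1 : ℕ), ω ^ (e.2.1 : ℕ), ω ^ (e.2.2.1 : ℕ), ω ^ (e.2.2.2 : ℕ)]
        j k := by
  fin_cases j <;> fin_cases k <;>
    simp [toeplitzEntry, LTT, eval_genPow hω, eval_zero, eval_one]

/-- All proper minors of the Toeplitz matrix with exponents `e` are nonzero. -/
def MinorsNonzero (e : Fin 7 × Fin 7 × Fin 7 × Fin 7) : Prop :=
  ∀ r ∈ [1, 2, 3, 4, 5], ∀ R ∈ List.sublistsLen r [0, 1, 2, 3, 4],
    ∀ C ∈ List.sublistsLen r [0, 1, 2, 3, 4],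
      List.Forall₂ (· ≤ ·) C R → minor (toeplitzEntry e) R C % 8 ≠ 0

instance : DecidablePred MinorsNonzero := fun e => by
  unfold MinorsNonzero
  infer_instance

end GF8

theorem mem_sublistsLen_range_iff {n r : ℕ} {l : List ℕ} :
    l ∈ List.sublistsLen r (List.range n) ↔
      ∃ f : Fin r → Fin n, StrictMono f ∧ l = List.ofFn fun t => (f t : ℕ) := by
  rw [List.mem_sublistsLen]
  constructor
  · rintro ⟨hl, rfl⟩
    have hlt (t : Fin l.length) : l.get t < n := List.mem_range.1 (hl.subset (l.get_mem t))
    refine ⟨fun t => ⟨l.get t, hlt t⟩, fun i j hij => ?_, by simp⟩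
    exact List.pairwise_iff_get.1 (List.pairwise_lt_range.sublist hl) i j hij
  · rintro ⟨f, hf, rfl⟩
    refine ⟨?_, by simp⟩
    have hp : (List.ofFn fun t => (f t : ℕ)).Pairwise (· < ·) :=
      List.pairwise_ofFn.2 fun i j hij => hf hij
    refine List.sublist_of_subperm_of_pairwise (r := (· < ·)) ?_ hp List.pairwise_lt_range
    refine List.subperm_of_subset (hp.imp ne_of_lt) fun x hx => ?_
    obtain ⟨t, rfl⟩ := (List.mem_ofFn' _ _).1 hx
    exact List.mem_range.2 (f t).isLt

theorem superregular_iff_minorsNonzero {F : Type*} [Field F] [CharP F 2] {ω : F}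
    (hω : ω ^ 3 + ω + 1 = 0) (e : Fin 7 × Fin 7 × Fin 7 × Fin 7) :
    Superregular (LTT ![(1 : F), ω ^ (e.1 : ℕ), ω ^ (e.2.1 : ℕ), ω ^ (e.2.2.1 : ℕ),
      ω ^ (e.2.2.2 : ℕ)]) ↔ GF8.MinorsNonzero e := by
  have hdet {r : ℕ} (row col : Fin r → Fin 5) :
      ((LTT ![(1 : F), ω ^ (e.1 : ℕ), ω ^ (e.2.1 : ℕ), ω ^ (e.2.2.1 : ℕ),
        ω ^ (e.2.2.2 : ℕ)]).submatrix row col).det = 0 ↔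
      GF8.minor (GF8.toeplitzEntry e) (List.ofFn fun t => (row t : ℕ))
        (List.ofFn fun t => (col t : ℕ)) % 8 = 0 := by
    rw [← GF8.eval_eq_zero_iff hω, GF8.eval_minor hω]
    simp only [GF8.eval_toeplitzEntry hω]
    rfl
  have hrange : [0, 1, 2, 3, 4] = List.range 5 := rfl
  simp only [GF8.MinorsNonzero, hrange, mem_sublistsLen_range_iff]
  constructor
  · rintro h r - _ ⟨row, hrow, rfl⟩ _ ⟨col, hcol, rfl⟩ hle
    refine (hdet row col).not.1 (h r row col hrow hcol fun t => ?_)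
    simpa using (List.forall₂_iff_get.1 hle).2 t (by simp) (by simp)
  · intro h r row col hrow hcol hle
    have hr : r ≤ 5 := by simpa using Fintype.card_le_of_injective row hrow.injective
    rcases Nat.eq_zero_or_pos r with rfl | hpos
    · simp
    refine (hdet row col).not.2 (h r (by simp; omega) _ ⟨row, hrow, rfl⟩ _ ⟨col, hcol, rfl⟩
      (List.forall₂_iff_get.2 ⟨by simp, fun i hi _ => ?_⟩))
    simpa using hle ⟨i, by simpa using hi⟩

theorem card_minorsNonzero_zero :
    (Finset.univ.filter fun f => GF8.MinorsNonzero (0, f)).card = 12 := by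
  decide +kernel

/-- Conjugation by a diagonal matrix of powers of `u` preserves superregularity. -/
theorem Superregular.scale {F : Type*} [Field F] {n : ℕ} {c : Fin n → F} {u : F} (hu : u ≠ 0)
    (h : Superregular (LTT c)) : Superregular (LTT fun i => u ^ (i : ℕ) * c i) := by
  intro r row col hrow hcol hle
  have hentry : (LTT fun i => u ^ (i : ℕ) * c i).submatrix row col =
      Matrix.of fun s t => u ^ (row s : ℕ) *
        (Matrix.of fun s t => (u ^ (col t : ℕ))⁻¹ * (LTT c).submatrix row col s t) s t := by
    ext s t
    by_cases hst : (col t : ℕ) ≤ (row s : ℕ)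
    · simp only [LTT, Matrix.submatrix_apply, Matrix.of_apply, if_pos hst, pow_sub₀ u hu hst]
      ring
    · simp only [LTT, Matrix.submatrix_apply, Matrix.of_apply, if_neg hst, mul_zero]
  rw [hentry, Matrix.det_mul_column, Matrix.det_mul_row]
  refine mul_ne_zero (Finset.prod_ne_zero_iff.2 fun s _ => pow_ne_zero _ hu)
    (mul_ne_zero (Finset.prod_ne_zero_iff.2 fun t _ => inv_ne_zero (pow_ne_zero _ hu))
      (h r row col hrow hcol hle))

/-- The action on exponents of scaling the `i`-th diagonal by `ω ^ (k i)`. -/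
def shiftExponents (k : Fin 7) (e : Fin 7 × Fin 7 × Fin 7 × Fin 7) :
    Fin 7 × Fin 7 × Fin 7 × Fin 7 :=
  (e.1 + k, e.2.1 + 2 * k, e.2.2.1 + 3 * k, e.2.2.2 + 4 * k)

theorem minorsNonzero_shiftExponents {F : Type*} [Field F] [CharP F 2] {ω : F}
    (hω : ω ^ 3 + ω + 1 = 0) (k : Fin 7) {e : Fin 7 × Fin 7 × Fin 7 × Fin 7}
    (h : GF8.MinorsNonzero e) : GF8.MinorsNonzero (shiftExponents k e) := by
  have h2 : (2 : F) = 0 := CharTwo.two_eq_zero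
  have h0 : ω ≠ 0 := by rintro rfl; simp at hω
  have h7 : ω ^ 7 = 1 := by grind
  have hmod (n : ℕ) : ω ^ (n % 7) = ω ^ n := (pow_eq_pow_mod n h7).symm
  rw [← superregular_iff_minorsNonzero hω] at h ⊢
  convert h.scale (pow_ne_zero k h0) using 2
  funext i
  fin_cases i <;>
    simp [shiftExponents, Fin.val_add, Fin.val_mul, hmod, pow_add, ← pow_mul, mul_comm]

theorem card_minorsNonzero {F : Type*} [Field F] [CharP F 2] {ω : F}
    (hω : ω ^ 3 + ω + 1 = 0) : (Finset.univ.filter GF8.MinorsNonzero).card = 84 := by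
  have himage : Finset.univ.filter GF8.MinorsNonzero =
      (Finset.univ ×ˢ Finset.univ.filter fun f => GF8.MinorsNonzero (0, f)).image
        fun p : Fin 7 × Fin 7 × Fin 7 × Fin 7 => shiftExponents p.1 (0, p.2) := by
    ext e
    simp only [Finset.mem_filter, Finset.mem_univ, true_and, Finset.mem_image,
      Finset.mem_product]
    constructor
    · intro h
      have h' := minorsNonzero_shiftExponents hω (-e.1) h
      refine ⟨(e.1, (shiftExponents (-e.1) e).2), ?_, ?_⟩
      · simpa [shiftExponents] using h'
      · simp [shiftExponents]
    · rintro ⟨p, hp, rfl⟩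
      exact minorsNonzero_shiftExponents hω p.1 hp
  rw [himage, Finset.card_image_of_injective, Finset.card_product, card_minorsNonzero_zero]
  · simp
  · rintro ⟨k, f⟩ ⟨k', f'⟩ h
    simp only [shiftExponents, Prod.mk.injEq, zero_add] at h
    obtain ⟨rfl, h₁, h₂, h₃⟩ := h
    simp [Prod.ext_iff, add_right_cancel h₁, add_right_cancel h₂, add_right_cancel h₃]

theorem stmt5 (ω : GaloisField 2 3) (hω : ω ^ 3 + ω + 1 = 0) :
    {v : Fin 7 × Fin 7 × Fin 7 × Fin 7 |
      Superregular
        (LTT ![(1 : GaloisField 2 3), ω ^ (v.1 : ℕ), ω ^ (v.2.1 : ℕ),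
               ω ^ (v.2.2.1 : ℕ), ω ^ (v.2.2.2 : ℕ)])}.ncard = 84 := by
  rw [← card_minorsNonzero hω, ← Set.ncard_coe_finset]
  congr 1
  ext e
  simpa using superregular_iff_minorsNonzero hω e
end

section
/- Over GF(2^8) generated by a root ω of ω⁸ + ω⁴ + ω³ + ω² + 1, the 10×10 lower triangular Toeplitz matrix with first column [1, ω^{125}, ω^{35}, ω^{109}, ω^{219}, ω^{83}, ω^{177}, ω^{191}, ω^{39}, ω^{23}]^T is superregular. -/
open Matrix

/-- The bytes of this number, from the lowest one up, are the coefficient vectors of the powers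
`x ^ 0, …, x ^ 509` modulo `x ^ 8 + x ^ 4 + x ^ 3 + x ^ 2 + 1` over `GF(2)`. -/
def gfExpTable : ℕ :=
  8856990713409824987183140402374358080674248354215423657725458004488207893438392946030888853375904797289504668347160626187132259699900233138648534461763796553722681762569641945119264861220663755468484037720775188535579952245867663006651507277791222666826785483398433307595704877043200076058100196638910845779782293078032926818358696911279575842852319355700605339911765372424152090200116912196812683442216396899668384855648195394238364200816963036045261203126476910443940504312987208021345653905171248397066478845569494078144977197837111232127732754508096250939318709245866461879354629945230799664051954596316140836780717108354261181748492094461244742858401085820322168057750326071736368712266714827098764897370398784052097986092416779378404705019203020335569119892153447474284880772368378344689255354826179669527487614603533424485383665010357433079299522588467683458117463774085267711371273156937819115392343347060478494473386782195599410389734005551742428694560297619569031029357707022930644351916425117765030612268580539533293361144518654644548322964103094579667389630079007276152875920723587307542406162776191331872344722220447978477718188404304137896878643387669563613408028725344812418906929574157450205698549093433583337985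

/-- The 9-bit blocks of this number, from the lowest one up, are the discrete logarithms to base
`x` of the bytes `0, …, 255`, with the value `511` for the byte `0`. -/
def gfLogTable : ℕ :=
  1280280666129305506491242481180088866442554547362231281020481580358701154733866488309625975995803819116197753141050798388089235934454355882155688931352126142854390448891823515454322415812333188797835138712414237451015274497135146335612793950700125157310848901987831313779598718555618996575584736512941848386540218789159252811110303610035868940219848586817678377017499259534606727074997524392257737633677286565498708958917864074164318560704460621759142991302926360892411337809451197026850311898867336779097127415111092663223532408816216007425731672065250628178009275297987242579187014394471291884643606450888154213300275160870132769308911457331615672733956798010522398461528257297707223463756287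

/-- The byte encoding the `i`-th power of the primitive element; `0` for `i ≥ 510`. -/
def gfExp (i : ℕ) : ℕ := (gfExpTable >>> (8 * i)) % 256

/-- The discrete logarithm of a byte; the logarithm of `0` is `511`. -/
def gfLog (a : ℕ) : ℕ := (gfLogTable >>> (9 * a)) % 512

/-- Multiplication of field elements encoded as bytes. -/
def gfMul (a b : ℕ) : ℕ := gfExp (gfLog a + gfLog b)

/-- The fraction-free Schur complement of the matrix with rows `a :: r` and `M` with respect to
the entry `a`. -/
def gfSchur (a : ℕ) (r : List ℕ) (M : List (List ℕ)) : List (List ℕ) :=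
  M.map fun w => List.zipWith (fun d u => gfMul a d ^^^ gfMul (w.headD 0) u) w.tail r

/-- Apply `k` to `n`, making the kernel evaluate `n` first. -/
def forceNat (n : ℕ) (k : ℕ → Bool) : Bool :=
  Nat.rec (k 0) (fun m _ => k (m + 1)) n

/-- Apply `k` to `l`, making the kernel evaluate all entries of `l` first. -/
def forceList : List ℕ → (List ℕ → Bool) → Bool
  | [], k => k []
  | a :: l, k => forceNat a fun a' => forceList l fun l' => k (a' :: l')

/-- Apply `k` to `M`, making the kernel evaluate all entries of `M` first. -/
def forceRows : List (List ℕ) → (List (List ℕ) → Bool) → Bool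
  | [], k => k []
  | r :: M, k => forceList r fun r' => forceRows M fun M' => k (r' :: M')

/-- Go through the pivots in the row `r` on top of the rows `M`, requiring each admissible one to
be nonzero and its Schur complement to pass the test `p`. -/
def checkPivots (p : List (List ℕ) → Bool) : List ℕ → List (List ℕ) → Bool
  | [], _ => true
  | a :: r, M =>
    (bif Nat.ble M.length r.length then Nat.blt 0 a && forceRows (gfSchur a r M) p else true) &&
      forceRows (M.map List.tail) (checkPivots p r)

/-- Test all proper minors of a matrix of bytes by elimination, with `n` steps of fuel. -/
def checkMinors : ℕ → List (List ℕ) → Bool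
  | 0, _ => false
  | _ + 1, [] => true
  | n + 1, r :: M => checkMinors n M && checkPivots (checkMinors n) r M

/-- The exponents of the first column of the Toeplitz matrix. -/
def toeplitzExponent (i : ℕ) : ℕ := [0, 125, 35, 109, 219, 83, 177, 191, 39, 23].getD i 0

/-- The Toeplitz matrix with entries encoded as bytes. -/
def toeplitzBytes : List (List ℕ) :=
  List.ofFn fun i : Fin 10 => List.ofFn fun j : Fin 10 =>
    if (j : ℕ) ≤ i then gfExp (toeplitzExponent (i - j)) else 0

theorem checkMinors_toeplitzBytes : forceRows toeplitzBytes (checkMinors 11) = true := by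
  decide +kernel

theorem forceNat_eq (n : ℕ) (k : ℕ → Bool) : forceNat n k = k n := by
  cases n <;> rfl

theorem forceList_eq (l : List ℕ) (k : List ℕ → Bool) : forceList l k = k l := by
  induction l generalizing k with
  | nil => rfl
  | cons a l ih => simp [forceList, forceNat_eq, ih]

theorem forceRows_eq (M : List (List ℕ)) (k : List (List ℕ) → Bool) : forceRows M k = k M := by
  induction M generalizing k with
  | nil => rfl
  | cons r M ih => simp [forceRows, forceList_eq, ih]

theorem gfExp_lt (i : ℕ) : gfExp i < 256 := Nat.mod_lt _ (by norm_num)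

theorem gfExp_zero : gfExp 0 = 1 := by decide +kernel

theorem gfExp_eq_zero {i : ℕ} (hi : 510 ≤ i) : gfExp i = 0 := by
  have h : gfExpTable < 2 ^ (8 * i) :=
    lt_of_lt_of_le (b := 2 ^ 4080) (by decide +kernel)
      (Nat.pow_le_pow_right (by norm_num) (by omega))
  simp [gfExp, Nat.shiftRight_eq_div_pow, Nat.div_eq_of_lt h]

theorem testBit_gfExp_succ : ∀ i < 509,
    (gfExp (i + 1)).testBit 0 = (gfExp i).testBit 7 ∧
    (gfExp (i + 1)).testBit 1 = (gfExp i).testBit 0 ∧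
    (gfExp (i + 1)).testBit 2 = ((gfExp i).testBit 1 ^^ (gfExp i).testBit 7) ∧
    (gfExp (i + 1)).testBit 3 = ((gfExp i).testBit 2 ^^ (gfExp i).testBit 7) ∧
    (gfExp (i + 1)).testBit 4 = ((gfExp i).testBit 3 ^^ (gfExp i).testBit 7) ∧
    (gfExp (i + 1)).testBit 5 = (gfExp i).testBit 4 ∧
    (gfExp (i + 1)).testBit 6 = (gfExp i).testBit 5 ∧
    (gfExp (i + 1)).testBit 7 = (gfExp i).testBit 6 := by
  decide +kernel

theorem gfLog_zero : gfLog 0 = 511 := by decide +kernel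

theorem gfLog_spec : ∀ a < 256, a ≠ 0 → gfLog a < 255 ∧ gfExp (gfLog a) = a := by
  decide +kernel

section Evaluation

variable {F : Type*} [Field F]

/-- The field element encoded by a byte, with respect to the primitive element `ω`. -/
def gfEval (ω : F) (n : ℕ) : F :=
  ∑ i ∈ Finset.range 8, ω ^ i * if n.testBit i then 1 else 0

theorem gfEval_zero (ω : F) : gfEval ω 0 = 0 := by
  simp [gfEval]

/-- The matrix entry encoded in a list of rows of bytes. -/
def gfEntry (ω : F) (M : List (List ℕ)) (i j : ℕ) : F :=
  gfEval ω ((M.getD i []).getD j 0)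

theorem gfEntry_map_tail (ω : F) (M : List (List ℕ)) (i j : ℕ) :
    gfEntry ω (M.map List.tail) i j = gfEntry ω M i (j + 1) := by
  have h : (M.map List.tail).getD i [] = (M.getD i []).tail :=
    List.getD_map M [] List.tail
  rw [gfEntry, gfEntry, h]
  cases M.getD i [] <;> simp

theorem ite_xor_eq_add [CharP F 2] (a b : Bool) :
    (if (a ^^ b) then 1 else 0 : F) = (if a then 1 else 0) + (if b then 1 else 0) := by
  cases a <;> cases b <;> simp [CharTwo.add_self_eq_zero]

theorem gfEval_xor [CharP F 2] (ω : F) (a b : ℕ) :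
    gfEval ω (a ^^^ b) = gfEval ω a + gfEval ω b := by
  simp only [gfEval, Nat.testBit_xor, ite_xor_eq_add, mul_add, Finset.sum_add_distrib]

variable [CharP F 2] {ω : F}

theorem gfEval_gfExp (hω : ω ^ 8 + ω ^ 4 + ω ^ 3 + ω ^ 2 + 1 = 0) {i : ℕ} (hi : i < 510) :
    gfEval ω (gfExp i) = ω ^ i := by
  induction i with
  | zero => simp [gfExp_zero, gfEval, Nat.testBit_one_eq_true_iff_self_eq_zero]
  | succ i ih =>
    obtain ⟨h0, h1, h2, h3, h4, h5, h6, h7⟩ := testBit_gfExp_succ i (by omega)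
    have h_two : (2 : F) = 0 := CharTwo.two_eq_zero
    rw [pow_succ, ← ih (by omega)]
    simp only [gfEval, Finset.sum_range_succ, Finset.sum_range_zero, h0, h1, h2, h3, h4, h5, h6,
      h7, ite_xor_eq_add]
    linear_combination (if (gfExp i).testBit 7 then 1 else 0) * (hω - ω ^ 8 * h_two)

theorem gfEval_ne_zero (hω : ω ^ 8 + ω ^ 4 + ω ^ 3 + ω ^ 2 + 1 = 0) {a : ℕ} (ha : a < 256)
    (h0 : a ≠ 0) : gfEval ω a ≠ 0 := by
  have hω0 : ω ≠ 0 := by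
    rintro rfl
    norm_num at hω
  obtain ⟨h1, h2⟩ := gfLog_spec a ha h0
  rw [← h2, gfEval_gfExp hω (by omega)]
  exact pow_ne_zero _ hω0

theorem gfEval_gfMul (hω : ω ^ 8 + ω ^ 4 + ω ^ 3 + ω ^ 2 + 1 = 0) {a b : ℕ} (ha : a < 256)
    (hb : b < 256) : gfEval ω (gfMul a b) = gfEval ω a * gfEval ω b := by
  rcases eq_or_ne a 0 with rfl | ha0
  · rw [gfMul, gfLog_zero, gfExp_eq_zero (by omega), gfEval_zero, zero_mul]
  rcases eq_or_ne b 0 with rfl | hb0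
  · rw [gfMul, gfLog_zero, gfExp_eq_zero (by omega), gfEval_zero, mul_zero]
  obtain ⟨ha1, ha2⟩ := gfLog_spec a ha ha0
  obtain ⟨hb1, hb2⟩ := gfLog_spec b hb hb0
  conv_rhs => rw [← ha2, ← hb2]
  rw [gfMul, gfEval_gfExp hω (by omega), gfEval_gfExp hω (by omega), gfEval_gfExp hω (by omega),
    pow_add]

/-- The rows in `M` consist of `c` bytes each. -/
def IsByteMatrix (c : ℕ) (M : List (List ℕ)) : Prop :=
  ∀ w ∈ M, w.length = c ∧ ∀ x ∈ w, x < 256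

theorem IsByteMatrix.getD_lt {c : ℕ} {M : List (List ℕ)} (h : IsByteMatrix c M) (i j : ℕ) :
    (M.getD i []).getD j 0 < 256 := by
  rcases lt_or_ge i M.length with hi | hi
  · rw [List.getD_eq_getElem _ _ hi]
    rcases lt_or_ge j (M[i]).length with hj | hj
    · rw [List.getD_eq_getElem _ _ hj]
      exact (h _ (List.getElem_mem hi)).2 _ (List.getElem_mem hj)
    · rw [List.getD_eq_default _ _ hj]
      norm_num
  · rw [List.getD_eq_default _ _ hi]
    norm_num

theorem IsByteMatrix.map_tail {c : ℕ} {M : List (List ℕ)} (h : IsByteMatrix (c + 1) M) :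
    IsByteMatrix c (M.map List.tail) := by
  intro w hw
  obtain ⟨w, hwM, rfl⟩ := List.mem_map.mp hw
  exact ⟨by simp [(h w hwM).1], fun x hx => (h w hwM).2 x (List.mem_of_mem_tail hx)⟩

theorem IsByteMatrix.gfSchur {a : ℕ} {r : List ℕ} {M : List (List ℕ)}
    (h : IsByteMatrix (r.length + 1) M) : IsByteMatrix r.length (gfSchur a r M) := by
  intro w hw
  obtain ⟨w, hwM, rfl⟩ := List.mem_map.mp hw
  refine ⟨by simp [(h w hwM).1], fun x hx => ?_⟩
  obtain ⟨i, hi, rfl⟩ := List.getElem_of_mem hx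
  rw [List.getElem_zipWith]
  exact Nat.xor_lt_two_pow (n := 8) (gfExp_lt _) (gfExp_lt _)

theorem gfEntry_gfSchur (hω : ω ^ 8 + ω ^ 4 + ω ^ 3 + ω ^ 2 + 1 = 0) {a : ℕ} {r : List ℕ}
    {M : List (List ℕ)} (h : IsByteMatrix (r.length + 1) ((a :: r) :: M)) {i j : ℕ}
    (hi : i < M.length) (hj : j < r.length) :
    gfEntry ω (gfSchur a r M) i j =
      gfEntry ω ((a :: r) :: M) 0 0 * gfEntry ω ((a :: r) :: M) (i + 1) (j + 1) +
        gfEntry ω ((a :: r) :: M) (i + 1) 0 * gfEntry ω ((a :: r) :: M) 0 (j + 1) := by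
  have hl : (M[i]).length = r.length + 1 :=
    (h _ (List.mem_cons_of_mem _ (List.getElem_mem hi))).1
  have e : ((gfSchur a r M).getD i []).getD j 0 =
      gfMul ((((a :: r) :: M).getD 0 []).getD 0 0) ((((a :: r) :: M).getD (i + 1) []).getD (j + 1) 0)
        ^^^ gfMul ((((a :: r) :: M).getD (i + 1) []).getD 0 0)
          ((((a :: r) :: M).getD 0 []).getD (j + 1) 0) := by
    obtain ⟨v, w, hw⟩ := List.exists_cons_of_length_eq_add_one hl
    have hwl : w.length = r.length := by simpa [hw] using hl
    have hjw : j < w.length := hwl ▸ hj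
    simp [_root_.gfSchur, hi, hw, hj, hjw]
  simp only [gfEntry]
  rw [e, gfEval_xor, gfEval_gfMul hω (h.getD_lt _ _) (h.getD_lt _ _),
    gfEval_gfMul hω (h.getD_lt _ _) (h.getD_lt _ _)]

/-- If a pivot is nonzero and the Schur complement has trivial kernel, so has the matrix. -/
theorem eq_zero_of_schur {K : Type*} [Field K] {r : ℕ} {B : Fin (r + 1) → Fin (r + 1) → K}
    (h0 : B 0 0 ≠ 0)
    (hS : ∀ v : Fin r → K, (∀ t, ∑ s, (B 0 0 * B (Fin.succ t) (Fin.succ s) -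
      B (Fin.succ t) 0 * B 0 (Fin.succ s)) * v s = 0) → v = 0)
    {v : Fin (r + 1) → K} (hv : ∀ t, ∑ s, B t s * v s = 0) : v = 0 := by
  have hs : (fun s => v (Fin.succ s)) = 0 := by
    refine hS _ fun t => ?_
    have e0 := hv 0
    have e1 := hv t.succ
    rw [Fin.sum_univ_succ] at e0 e1
    simp only [sub_mul, mul_assoc, Finset.sum_sub_distrib, ← Finset.mul_sum]
    linear_combination B 0 0 * e1 - B t.succ 0 * e0
  have hs' : ∀ s, v (Fin.succ s) = 0 := fun s => congrFun hs s
  have e0 := hv 0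
  rw [Fin.sum_univ_succ] at e0
  simp only [hs', mul_zero, Finset.sum_const_zero, add_zero] at e0
  funext s
  refine Fin.cases ?_ hs' s
  exact (mul_eq_zero.mp e0).resolve_left h0

/-- All proper minors of the `M.length × c` matrix encoded by `M` have trivial kernel. A minor is
proper if its diagonal stays weakly below the diagonal ending in the bottom right corner. -/
def ProperMinorsNonsingular (ω : F) (c : ℕ) (M : List (List ℕ)) : Prop :=
  ∀ (r : ℕ) (row col : Fin r → ℕ), StrictMono row → StrictMono col →
    (∀ t, row t < M.length) → (∀ t, col t < c) → (∀ t, M.length + col t ≤ c + row t) →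
    ∀ v : Fin r → F, (∀ t, ∑ s, gfEntry ω M (row t) (col s) * v s = 0) → v = 0

theorem exists_eq_succ {r : ℕ} {f : Fin (r + 1) → ℕ} (hf : StrictMono f) (h0 : f 0 ≠ 0) :
    ∃ g : Fin (r + 1) → ℕ, StrictMono g ∧ ∀ t, f t = g t + 1 := by
  have h : ∀ t, f t = f t - 1 + 1 := fun t => by
    have := hf.monotone (Fin.zero_le t)
    omega
  refine ⟨fun t => f t - 1, fun s t hst => ?_, h⟩
  have := hf hst
  have := h s
  show f s - 1 < f t - 1
  omega

theorem exists_succ_eq_succ {r : ℕ} {f : Fin (r + 1) → ℕ} (hf : StrictMono f) :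
    ∃ g : Fin r → ℕ, StrictMono g ∧ ∀ t, f (Fin.succ t) = g t + 1 := by
  have h : ∀ t : Fin r, f t.succ = f t.succ - 1 + 1 := fun t => by
    have := hf (Fin.succ_pos t)
    omega
  refine ⟨fun t => f t.succ - 1, fun s t hst => ?_, h⟩
  have := hf (Fin.succ_lt_succ_iff.mpr hst)
  have := h s
  show f s.succ - 1 < f t.succ - 1
  omega

theorem eq_zero_of_checkPivots (hω : ω ^ 8 + ω ^ 4 + ω ^ 3 + ω ^ 2 + 1 = 0)
    {p : List (List ℕ) → Bool}
    (hp : ∀ c M, IsByteMatrix c M → p M = true → ProperMinorsNonsingular ω c M)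
    {l : List ℕ} {M : List (List ℕ)} (hM : IsByteMatrix l.length (l :: M))
    (hc : checkPivots p l M = true) {r : ℕ} {row col : Fin (r + 1) → ℕ} (hrow : StrictMono row)
    (hcol : StrictMono col) (hr : ∀ t, row t < M.length + 1) (hl : ∀ t, col t < l.length)
    (hproper : ∀ t, M.length + 1 + col t ≤ l.length + row t) (hr0 : row 0 = 0)
    {v : Fin (r + 1) → F} (hv : ∀ t, ∑ s, gfEntry ω (l :: M) (row t) (col s) * v s = 0) :
    v = 0 := by
  induction l generalizing M col with
  | nil => simpa using hl 0
  | cons a l ih =>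
    simp only [checkPivots, forceRows_eq, Bool.and_eq_true] at hc
    simp only [List.length_cons] at hM hl hproper
    by_cases h0 : col 0 = 0
    · have hle : M.length ≤ l.length := by
        have := hproper 0
        omega
      simp only [Nat.ble_eq.mpr hle, cond_true, Bool.and_eq_true, Nat.blt_eq] at hc
      have hM' : IsByteMatrix (l.length + 1) M := fun w hw => hM w (List.mem_cons_of_mem _ hw)
      obtain ⟨row', hrow', er⟩ := exists_succ_eq_succ hrow
      obtain ⟨col', hcol', ec⟩ := exists_succ_eq_succ hcol
      have hr' : ∀ t, row' t < M.length := fun t => by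
        have := hr t.succ
        have := er t
        omega
      have hl' : ∀ t, col' t < l.length := fun t => by
        have := hl t.succ
        have := ec t
        omega
      refine eq_zero_of_schur (B := fun t s => gfEntry ω ((a :: l) :: M) (row t) (col s)) ?_ ?_ hv
      · rw [hr0, h0]
        exact gfEval_ne_zero hω (hM.getD_lt 0 0) (by simpa using hc.1.1.ne')
      · intro u hu
        refine hp _ _ hM'.gfSchur hc.1.2 _ row' col' hrow' hcol' (by simpa [gfSchur] using hr') hl'
          (fun t => ?_) u fun t => ?_
        · have := hproper t.succ
          rw [er, ec] at this
          simp only [gfSchur, List.length_map]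
          omega
        · rw [← hu t]
          refine Finset.sum_congr rfl fun s _ => ?_
          rw [gfEntry_gfSchur hω hM (hr' t) (hl' s), hr0, h0, er, ec, CharTwo.sub_eq_add]
    · obtain ⟨col', hcol', ec⟩ := exists_eq_succ hcol h0
      have hM' : IsByteMatrix l.length (l :: M.map List.tail) := hM.map_tail
      refine ih hM' hc.2 hcol' (by simpa using hr) (fun t => ?_) (fun t => ?_) fun t => ?_
      · have := hl t
        have := ec t
        omega
      · have := hproper t
        have := ec t
        simp only [List.length_map]
        omega
      · rw [← hv t]
        refine Finset.sum_congr rfl fun s _ => ?_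
        rw [ec, ← gfEntry_map_tail]
        rfl

theorem properMinorsNonsingular_of_checkMinors (hω : ω ^ 8 + ω ^ 4 + ω ^ 3 + ω ^ 2 + 1 = 0)
    (n c : ℕ) (M : List (List ℕ)) (hM : IsByteMatrix c M) (hc : checkMinors n M = true) :
    ProperMinorsNonsingular ω c M := by
  induction n generalizing c M with
  | zero => simp [checkMinors] at hc
  | succ n ih =>
    intro r row col hrow hcol hr hl hproper v hv
    cases r with
    | zero => exact Subsingleton.elim _ _
    | succ r =>
      cases M with
      | nil => simpa using hr 0
      | cons w M =>
        obtain rfl : w.length = c := (hM w List.mem_cons_self).1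
        simp only [checkMinors, Bool.and_eq_true] at hc
        by_cases h0 : row 0 = 0
        · exact eq_zero_of_checkPivots hω ih hM hc.2 hrow hcol hr hl hproper h0 hv
        · obtain ⟨row', hrow', er⟩ := exists_eq_succ hrow h0
          refine ih _ M (fun x hx => hM x (List.mem_cons_of_mem _ hx)) hc.1 _ row' col hrow' hcol
            (fun t => ?_) hl (fun t => ?_) v fun t => ?_
          · have := hr t
            rw [er, List.length_cons] at this
            omega
          · have := hproper t
            rw [er, List.length_cons] at this
            omega
          · rw [← hv t, er]
            rfl

theorem getD_ofFn {α : Type*} {n : ℕ} (f : Fin n → α) (i : Fin n) (d : α) :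
    (List.ofFn f).getD i d = f i := by
  rw [List.getD_eq_getElem (hn := by rw [List.length_ofFn]; exact i.isLt), List.getElem_ofFn]

theorem isByteMatrix_toeplitzBytes : IsByteMatrix 10 toeplitzBytes := by
  unfold IsByteMatrix
  decide +kernel

theorem gfEntry_toeplitzBytes (hω : ω ^ 8 + ω ^ 4 + ω ^ 3 + ω ^ 2 + 1 = 0) (i j : Fin 10) :
    gfEntry ω toeplitzBytes i j =
      if (j : ℕ) ≤ i then ω ^ toeplitzExponent (i - j) else 0 := by
  have h : ∀ k, toeplitzExponent k < 510 := fun k => by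
    rcases lt_or_ge k 10 with hk | hk
    · interval_cases k <;> decide
    · rw [toeplitzExponent, List.getD_eq_default _ _ hk]
      norm_num
  simp only [gfEntry, toeplitzBytes]
  rw [getD_ofFn, getD_ofFn]
  split_ifs with hij
  · exact gfEval_gfExp hω (h _)
  · exact gfEval_zero ω

end Evaluation

theorem stmt14 (ω : GaloisField 2 8) (hω : ω ^ 8 + ω ^ 4 + ω ^ 3 + ω ^ 2 + 1 = 0) :
    Superregular
      (LTT ![(1 : GaloisField 2 8), ω ^ 125, ω ^ 35, ω ^ 109, ω ^ 219, ω ^ 83,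
             ω ^ 177, ω ^ 191, ω ^ 39, ω ^ 23]) := by
  have hcheck : checkMinors 11 toeplitzBytes = true := by
    rw [← forceRows_eq toeplitzBytes (checkMinors 11)]
    exact checkMinors_toeplitzBytes
  have hc : ∀ k : Fin 10, ![(1 : GaloisField 2 8), ω ^ 125, ω ^ 35, ω ^ 109, ω ^ 219, ω ^ 83,
      ω ^ 177, ω ^ 191, ω ^ 39, ω ^ 23] k = ω ^ toeplitzExponent k := by
    intro k
    fin_cases k <;> simp [toeplitzExponent]
  have hlen : toeplitzBytes.length = 10 := by simp [toeplitzBytes]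
  intro r row col hrow hcol hproper hdet
  obtain ⟨v, hv0, hv⟩ := Matrix.exists_mulVec_eq_zero_iff.mpr hdet
  refine hv0 (properMinorsNonsingular_of_checkMinors hω 11 10 toeplitzBytes
    isByteMatrix_toeplitzBytes hcheck r (fun t => row t) (fun t => col t) hrow hcol
    (fun t => by simp [hlen]) (fun t => (col t).isLt) (fun t => ?_) v fun t => ?_)
  · rw [hlen]
    exact Nat.add_le_add_left (hproper t) 10
  · refine (Finset.sum_congr rfl fun s _ => ?_).trans (congrFun hv t)
    rw [gfEntry_toeplitzBytes hω]
    simp only [Matrix.submatrix_apply, LTT, Matrix.of_apply, hc]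
end

section
/- Over GF(2^8) generated by a root ω of ω⁸ + ω⁴ + ω³ + ω² + 1, the 10×10 lower triangular Toeplitz matrix with first column [1, ω¹, ω⁰, ω⁰, ω³, ω⁵, ω^{10}, ω^{36}, ω^{86}, ω^{83}]^T = [1, 2, 1, 1, 8, 32, 116, 37, 177, 187]^T is superregular. -/
open Matrix

namespace GF256

/-- The element of a ring represented by a byte: bit `i` is the coefficient of `ω ^ i`. -/
def ofByte {F : Type*} [Semiring F] (ω : F) (x : ℕ) : F :=
  ∑ i ∈ Finset.range 8, if x.testBit i then ω ^ i else 0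

/-- Multiplication by the generator on bytes. -/
def mulGen (x : ℕ) : ℕ :=
  if x.testBit 7 then (2 * x) ^^^ 285 else 2 * x

/-- The byte of the `i`-th power of the generator, for `i < 255`, read from a packed table. -/
def expByte (i : ℕ) : ℕ :=
  (70160881166704368827218703435136616750530459438269794890424969378298545675077208731798828898087927652446353395360628748027273188182808436399538186061104243134188885576122562338679313492324190829158544377810568631194580132524405266702234305646236648896994794467054525044798919765581988418950285252905306116225263236585714808161311289784028762024137133735135393922581566890382566480334369299400480864790538739986285574563168380416343369614948461817839620668187777978661530364712890858126432457562886306102556561631759900551331094983229723298224611133722330829711659991602983068895685602467964643306841827719562658305 >>> (8 * i)) % 256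

/-- The discrete logarithm of a nonzero byte, read from a packed table. -/
def logByte (x : ℕ) : ℕ :=
  (22135253156888987530748098150270024343632497605293634117281264061560962248099620766229961468867162294233796152347975563017024165690400661622462404646302566225833645086064538892198543335321514950294300187779610338557442029018619797274438901674641748676613670242915365385819254959901651105240253464034662486586186382979728982817772067067513442677601938078891989292316012868233806586592927239821351197800766822366321181463280924672822998103315976779850880337712374790938628529953751181886374687897611504386983350015558142994211516619836411558782076806704747441947939324473761869443721989389604670425385080942269787340800 >>> (8 * (x % 256))) % 256

/-- The byte representing `y - (q / p) * x`, for a nonzero pivot `p`. -/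
def elimByte (p q x y : ℕ) : ℕ :=
  if q % 256 = 0 then y else if x % 256 = 0 then y else
    y ^^^ expByte ((logByte q + (255 - logByte p) + logByte x) % 255)

/-- Application `k n`, arranged so that kernel reduction evaluates `n` first. -/
def force (n : ℕ) (k : ℕ → Bool) : Bool :=
  Nat.casesOn n (k 0) fun m => k m.succ

/-- Continuation passing form of `List.zipWith (elimByte p q)`. -/
def elimRow (p q : ℕ) : List ℕ → List ℕ → (List ℕ → Bool) → Bool
  | x :: xs, y :: ys, k => force (elimByte p q x y) fun z => elimRow p q xs ys fun zs => k (z :: zs)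
  | _, _, k => k []

/-- Schur complement of the pivot `p` in the row `p :: xs`, passed to a continuation. -/
def elimRows (p : ℕ) (xs : List ℕ) : List (List ℕ) → (List (List ℕ) → Bool) → Bool
  | (q :: ys) :: rs, k => elimRow p q xs ys fun zs => elimRows p xs rs fun l => k (zs :: l)
  | _, k => k []

/-- Deletion of the first column, passed to a continuation. -/
def dropCol : List (List ℕ) → (List (List ℕ) → Bool) → Bool
  | (_ :: ys) :: rs, k => dropCol rs fun l => k (ys :: l)
  | _, k => k []

/-- Check every pivot in the first column, at or below the diagonal, and apply `next` to the
Schur complements. The first row and column have indices `j` and `h`. -/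
def checkCol (next : List (List ℕ) → ℕ → ℕ → Bool) : List (List ℕ) → ℕ → ℕ → Bool
  | (p :: xs) :: rs, j, h =>
    checkCol next rs (j + 1) h &&
      (!(Nat.ble h j) || (!(Nat.beq (p % 256) 0) &&
        elimRows p xs rs fun l => next l (j + 1) (h + 1)))
  | _, _, _ => true

/-- Check all sequences of pivots of a matrix of bytes. -/
def check : ℕ → List (List ℕ) → ℕ → ℕ → Bool
  | 0, _, _, _ => false
  | n + 1, (p :: xs) :: rs, j, h =>
    checkCol (check n) ((p :: xs) :: rs) j h &&
      dropCol ((p :: xs) :: rs) fun l => check n l j (h + 1)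
  | _ + 1, _, _, _ => true

/-- The rows of the lower triangular Toeplitz matrix with first column
`1, 2, 1, 1, 8, 32, 116, 37, 177, 187`. -/
def toeplitzRows : List (List ℕ) :=
  [[1, 0, 0, 0, 0, 0, 0, 0, 0, 0],
   [2, 1, 0, 0, 0, 0, 0, 0, 0, 0],
   [1, 2, 1, 0, 0, 0, 0, 0, 0, 0],
   [1, 1, 2, 1, 0, 0, 0, 0, 0, 0],
   [8, 1, 1, 2, 1, 0, 0, 0, 0, 0],
   [32, 8, 1, 1, 2, 1, 0, 0, 0, 0],
   [116, 32, 8, 1, 1, 2, 1, 0, 0, 0],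
   [37, 116, 32, 8, 1, 1, 2, 1, 0, 0],
   [177, 37, 116, 32, 8, 1, 1, 2, 1, 0],
   [187, 177, 37, 116, 32, 8, 1, 1, 2, 1]]

theorem check_toeplitzRows : check 11 toeplitzRows 0 0 = true := by
  decide +kernel

section Field

variable {F : Type*} [Field F]

/-- The Schur complement of the pivot at `(j, h)`. -/
def schur (M : ℕ → ℕ → F) (j h : ℕ) (a b : ℕ) : F :=
  M a b - M a h / M j h * M j b

theorem det_eq_mul_det_schur (M : ℕ → ℕ → F) {r : ℕ} (row col : Fin (r + 1) → ℕ)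
    (hp : M (row 0) (col 0) ≠ 0) :
    (Matrix.of fun s t => M (row s) (col t)).det = M (row 0) (col 0) *
      (Matrix.of fun s t : Fin r =>
        schur M (row 0) (col 0) (row s.succ) (col t.succ)).det := by
  set B : Matrix (Fin (r + 1)) (Fin (r + 1)) F := Matrix.of (Fin.cons (fun t => M (row 0) (col t))
    fun s t => schur M (row 0) (col 0) (row s.succ) (col t)) with hB
  have h : (Matrix.of fun s t => M (row s) (col t)).det = B.det := by
    refine Matrix.det_eq_of_forall_row_eq_smul_add_const
      (Fin.cons 0 fun s => M (row s.succ) (col 0) / M (row 0) (col 0)) 0 rfl fun s t => ?_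
    refine Fin.cases ?_ (fun s => ?_) s <;> simp [hB, schur]
  rw [h, Matrix.det_succ_column_zero, Fin.sum_univ_succ]
  have hz : ∀ s : Fin r, B s.succ 0 = 0 := fun s => by simp [hB, schur, hp]
  simp only [hz, mul_zero, zero_mul, Finset.sum_const_zero, add_zero]
  simp only [Fin.val_zero, pow_zero, one_mul]
  congr 1

/-- All minors of `M` with rows in `[j, N)`, columns in `[h, N)` and diagonal entries at or below
the diagonal of `M` are nonzero. -/
def ProperMinorsNeZero (N : ℕ) (M : ℕ → ℕ → F) (j h : ℕ) : Prop :=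
  ∀ (r : ℕ) (row col : Fin r → ℕ), StrictMono row → StrictMono col →
    (∀ t, j ≤ row t ∧ row t < N) → (∀ t, h ≤ col t ∧ col t < N) → (∀ t, col t ≤ row t) →
    (Matrix.of fun s t => M (row s) (col t)).det ≠ 0

variable (N : ℕ) (ω : F)

/-- The bytes `xs` represent `f h, …, f (N - 1)`. -/
def RowRep : List ℕ → ℕ → (ℕ → F) → Prop
  | [], h, _ => h = N
  | x :: xs, h, f => h < N ∧ ofByte ω x = f h ∧ RowRep xs (h + 1) f

/-- The bytes represent the part of `M` with rows in `[j, N)` and columns in `[h, N)`. -/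
def Rep : List (List ℕ) → ℕ → ℕ → (ℕ → ℕ → F) → Prop
  | [], j, _, _ => j = N
  | r :: rs, j, h, M => RowRep N ω r h (M j) ∧ Rep rs (j + 1) h M

theorem force_eq (n : ℕ) (k : ℕ → Bool) : force n k = k n := by
  cases n <;> rfl

variable {N ω}

theorem elimRow_sound {p q : ℕ} {a b : F} {f g : ℕ → F}
    (hel : ∀ x y, ofByte ω (elimByte p q x y) = ofByte ω y - b / a * ofByte ω x) :
    ∀ (xs ys : List ℕ) (h : ℕ) (k : List ℕ → Bool), RowRep N ω xs h f → RowRep N ω ys h g →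
      elimRow p q xs ys k = true →
      ∃ zs, RowRep N ω zs h (fun i => g i - b / a * f i) ∧ k zs = true
  | [], [], h, k, hx, _, hk => ⟨[], hx, hk⟩
  | [], y :: ys, h, k, hx, hy, _ => absurd hx hy.1.ne
  | x :: xs, [], h, k, hx, hy, _ => absurd hy hx.1.ne
  | x :: xs, y :: ys, h, k, hx, hy, hk => by
    rw [elimRow, force_eq] at hk
    obtain ⟨zs, hz, hk⟩ := elimRow_sound hel xs ys (h + 1) _ hx.2.2 hy.2.2 hk
    exact ⟨_ :: zs, ⟨hx.1, by rw [hel, hx.2.1, hy.2.1], hz⟩, hk⟩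

theorem elimRows_sound {p : ℕ} {xs : List ℕ} {M : ℕ → ℕ → F} {j h : ℕ}
    (hel : ∀ q x y, ofByte ω (elimByte p q x y) =
      ofByte ω y - ofByte ω q / ofByte ω p * ofByte ω x)
    (hx : RowRep N ω (p :: xs) h (M j)) :
    ∀ (rs : List (List ℕ)) (i : ℕ) (k : List (List ℕ) → Bool), Rep N ω rs i h M →
      elimRows p xs rs k = true →
      ∃ l, Rep N ω l i (h + 1) (schur M j h) ∧ k l = true
  | [], i, k, hr, hk => ⟨[], hr, hk⟩
  | [] :: rs, i, k, hr, _ => absurd hr.1 hx.1.ne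
  | (q :: ys) :: rs, i, k, hr, hk => by
    rw [elimRows] at hk
    obtain ⟨zs, hz, hk⟩ := elimRow_sound (hel q) xs ys (h + 1) _ hx.2.2 hr.1.2.2 hk
    obtain ⟨l, hl, hk⟩ := elimRows_sound hel hx rs (i + 1) _ hr.2 hk
    refine ⟨zs :: l, ⟨?_, hl⟩, hk⟩
    rw [hx.2.1, hr.1.2.1] at hz
    exact hz

theorem dropCol_sound {M : ℕ → ℕ → F} {h : ℕ} (hh : h < N) :
    ∀ (rs : List (List ℕ)) (j : ℕ) (k : List (List ℕ) → Bool), Rep N ω rs j h M →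
      dropCol rs k = true → ∃ l, Rep N ω l j (h + 1) M ∧ k l = true
  | [], _, _, hr, hk => ⟨[], hr, hk⟩
  | [] :: _, _, _, hr, _ => absurd hr.1 hh.ne
  | (_ :: _) :: rs, j, _, hr, hk => by
    rw [dropCol] at hk
    obtain ⟨l, hl, hk⟩ := dropCol_sound hh rs (j + 1) _ hr.2 hk
    exact ⟨_ :: l, ⟨hr.1.2.2, hl⟩, hk⟩

/-- The arithmetic on bytes is that of `F`. -/
structure ByteArith (ω : F) : Prop where
  ofByte_ne_zero : ∀ p, p % 256 ≠ 0 → ofByte ω p ≠ 0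
  ofByte_elimByte : ∀ p, p % 256 ≠ 0 → ∀ q x y, ofByte ω (elimByte p q x y) =
    ofByte ω y - ofByte ω q / ofByte ω p * ofByte ω x

theorem checkCol_sound (hω : ByteArith ω) {next : List (List ℕ) → ℕ → ℕ → Bool}
    (hnext : ∀ rs j h M, Rep N ω rs j h M → next rs j h = true → ProperMinorsNeZero N M j h)
    {M : ℕ → ℕ → F} {h : ℕ} :
    ∀ (rs : List (List ℕ)) (j : ℕ), Rep N ω rs j h M → checkCol next rs j h = true →
      ∀ (r : ℕ) (row col : Fin (r + 1) → ℕ), StrictMono row → StrictMono col →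
        (∀ t, j ≤ row t ∧ row t < N) → col 0 = h → (∀ t, col t < N) → (∀ t, col t ≤ row t) →
        (Matrix.of fun s t => M (row s) (col t)).det ≠ 0
  | [], j, hr, _, _, row, _, _, _, hrow, _, _, _ => by
    have := hrow 0
    have : j = N := hr
    omega
  | [] :: rs, j, hr, _, _, _, col, _, _, _, h0, hcol, _ => by
    have := hcol 0
    have : h = N := hr.1
    omega
  | (p :: xs) :: rs, j, hr, hc, r, row, col, mrow, mcol, hrow, h0, hcol, hd => by
    simp only [checkCol, Bool.and_eq_true, Bool.or_eq_true, Bool.not_eq_true'] at hc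
    obtain ⟨hc, hp⟩ := hc
    by_cases hj : row 0 = j
    · rcases hp with hp | ⟨hp, hk⟩
      · have := Nat.ble_eq_true_of_le (h0 ▸ hj ▸ hd 0 : h ≤ j)
        simp [this] at hp
      have hp : p % 256 ≠ 0 := fun h => by simp [h] at hp
      obtain ⟨l, hl, hk⟩ := elimRows_sound (hω.ofByte_elimByte p hp) hr.1 rs (j + 1) _ hr.2 hk
      have hM : M (row 0) (col 0) ≠ 0 := by
        rw [hj, h0, ← hr.1.2.1]
        exact hω.ofByte_ne_zero p hp
      rw [det_eq_mul_det_schur M row col hM]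
      refine mul_ne_zero hM ?_
      rw [hj, h0]
      refine hnext l _ _ _ hl hk r (fun s => row s.succ) (fun s => col s.succ)
        (fun a b hab => mrow (Fin.succ_lt_succ_iff.2 hab))
        (fun a b hab => mcol (Fin.succ_lt_succ_iff.2 hab))
        (fun t => ⟨?_, (hrow _).2⟩) (fun t => ⟨?_, hcol _⟩) (fun t => hd _)
      · have := mrow (Fin.succ_pos t)
        omega
      · have := mcol (Fin.succ_pos t)
        omega
    · refine checkCol_sound hω hnext rs (j + 1) hr.2 hc r row col mrow mcol
        (fun t => ⟨?_, (hrow t).2⟩) h0 hcol hd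
      have := mrow.monotone (Fin.zero_le t)
      have := (hrow 0).1
      omega

theorem check_sound (hω : ByteArith ω) :
    ∀ (n : ℕ) (rs : List (List ℕ)) (j h : ℕ) (M : ℕ → ℕ → F), Rep N ω rs j h M →
      check n rs j h = true → ProperMinorsNeZero N M j h := by
  intro n
  induction n with
  | zero => intro _ _ _ _ _ hc; simp [check] at hc
  | succ n ih =>
    intro rs j h M hr hc r row col mrow mcol hrow hcol hd
    cases r with
    | zero => simp
    | succ r =>
      match rs, hr, hc with
      | [], hr, _ =>
        have := hrow 0
        have : j = N := hr
        omega
      | [] :: rs, hr, _ =>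
        have := hcol 0
        have : h = N := hr.1
        omega
      | (p :: xs) :: rs, hr, hc =>
        rw [check, Bool.and_eq_true] at hc
        by_cases h0 : col 0 = h
        · exact checkCol_sound hω ih _ j hr hc.1 r row col mrow mcol hrow h0
            (fun t => (hcol t).2) hd
        · obtain ⟨l, hl, hk⟩ := dropCol_sound hr.1.1 _ j _ hr hc.2
          refine ih l j (h + 1) M hl hk _ row col mrow mcol hrow (fun t => ⟨?_, (hcol t).2⟩) hd
          have := mcol.monotone (Fin.zero_le t)
          have := (hcol 0).1
          omega

end Field

section OfByte

variable {F : Type*} [Field F] {ω : F}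

theorem ofByte_mod (x : ℕ) : ofByte ω (x % 256) = ofByte ω x := by
  refine Finset.sum_congr rfl fun i hi => ?_
  rw [show 256 = 2 ^ 8 from rfl, Nat.testBit_mod_two_pow]
  simp [Finset.mem_range.1 hi]

theorem ofByte_zero : ofByte ω 0 = 0 := by
  simp [ofByte]

theorem ofByte_one : ofByte ω 1 = 1 := by
  simp [ofByte, Finset.sum_range_succ, Nat.testBit]

theorem ofByte_two_mul (x : ℕ) :
    ofByte ω (2 * x) + (if x.testBit 7 then ω ^ 8 else 0) = ω * ofByte ω x := by
  have h0 : (2 * x).testBit 0 = false := by simp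
  have hs (i : ℕ) : (2 * x).testBit (i + 1) = x.testBit i := by
    rw [Nat.testBit_succ]
    simp
  rw [ofByte, ofByte, Finset.sum_range_succ', Finset.sum_range_succ _ 7, mul_add, Finset.mul_sum]
  simp only [h0, hs, mul_ite, mul_zero, ← pow_succ']
  simp

end OfByte

section CharTwo

variable {F : Type*} [Field F] [CharP F 2] {ω : F}

theorem ofByte_xor (x y : ℕ) : ofByte ω (x ^^^ y) = ofByte ω x + ofByte ω y := by
  simp only [ofByte, ← Finset.sum_add_distrib, Nat.testBit_xor]
  refine Finset.sum_congr rfl fun i _ => ?_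
  cases x.testBit i <;> cases y.testBit i <;> simp [CharTwo.add_self_eq_zero]

variable (hω : ω ^ 8 + ω ^ 4 + ω ^ 3 + ω ^ 2 + 1 = 0)

include hω

theorem ofByte_mulGen (x : ℕ) : ofByte ω (mulGen x) = ω * ofByte ω x := by
  have h : ofByte ω 285 = ω ^ 8 := by
    have h : ofByte ω 285 = 1 + ω ^ 2 + ω ^ 3 + ω ^ 4 := by
      simp [ofByte, Finset.sum_range_succ, Nat.testBit]
    rw [h]
    linear_combination hω - ω ^ 8 * (CharTwo.two_eq_zero : (2 : F) = 0)
  rw [← ofByte_two_mul, mulGen]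
  split_ifs
  · rw [ofByte_xor, h]
  · rw [add_zero]

theorem ofByte_expByte_of_le : ∀ i ≤ 254, ofByte ω (expByte i) = ω ^ i := by
  have step : ∀ i < 254, expByte (i + 1) = mulGen (expByte i) := by decide +kernel
  intro i
  induction i with
  | zero =>
    intro _
    rw [show expByte 0 = 1 by decide +kernel, ofByte_one, pow_zero]
  | succ i ih =>
    intro hi
    rw [step i (by omega), ofByte_mulGen hω, ih (by omega), pow_succ']

theorem pow_255 : ω ^ 255 = 1 := by
  rw [pow_succ', ← ofByte_expByte_of_le hω 254 le_rfl, ← ofByte_mulGen hω,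
    show mulGen (expByte 254) = 1 by decide +kernel, ofByte_one]

theorem ofByte_expByte (i : ℕ) : ofByte ω (expByte (i % 255)) = ω ^ i := by
  rw [ofByte_expByte_of_le hω _ (by omega), ← pow_eq_pow_mod i (pow_255 hω)]

theorem ofByte_eq_pow_logByte {x : ℕ} (hx : x % 256 ≠ 0) : ofByte ω x = ω ^ logByte x := by
  have table : ∀ x < 256, x ≠ 0 → expByte (logByte x % 255) = x := by decide +kernel
  have := table (x % 256) (Nat.mod_lt _ (by norm_num)) hx
  rw [← ofByte_mod, ← this, ofByte_expByte hω]
  simp [logByte]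

theorem byteArith : ByteArith ω := by
  have h0 : ω ≠ 0 := by
    rintro rfl
    simp at hω
  have hne (p : ℕ) (hp : p % 256 ≠ 0) : ofByte ω p ≠ 0 := by
    rw [ofByte_eq_pow_logByte hω hp]
    exact pow_ne_zero _ h0
  have hz (x : ℕ) (hx : x % 256 = 0) : ofByte ω x = 0 := by
    rw [← ofByte_mod, hx, ofByte_zero]
  refine ⟨hne, fun p hp q x y => ?_⟩
  rw [elimByte]
  split_ifs with hq hx
  · simp [hz q hq]
  · simp [hz x hx]
  · have hlog : logByte p ≤ 255 := Nat.le_of_lt_succ (Nat.mod_lt _ (by norm_num))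
    have hinv : ω ^ logByte p * ω ^ (255 - logByte p) = 1 := by
      rw [← pow_add, Nat.add_sub_cancel' hlog, pow_255 hω]
    rw [ofByte_xor, ofByte_expByte hω, CharTwo.sub_eq_add, ofByte_eq_pow_logByte hω hp,
      ofByte_eq_pow_logByte hω hq, ofByte_eq_pow_logByte hω hx, pow_add, pow_add,
      div_eq_mul_inv, eq_inv_of_mul_eq_one_right hinv]

end CharTwo

end GF256

theorem stmt15 (ω : GaloisField 2 8) (hω : ω ^ 8 + ω ^ 4 + ω ^ 3 + ω ^ 2 + 1 = 0) :
    Superregular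
      (LTT ![(1 : GaloisField 2 8), ω ^ 1, ω ^ 0, ω ^ 0, ω ^ 3, ω ^ 5,
             ω ^ 10, ω ^ 36, ω ^ 86, ω ^ 83]) := by
  intro r row col mrow mcol hd
  set c : Fin 10 → GaloisField 2 8 := ![(1 : GaloisField 2 8), ω ^ 1, ω ^ 0, ω ^ 0, ω ^ 3, ω ^ 5,
    ω ^ 10, ω ^ 36, ω ^ 86, ω ^ 83] with hc
  set M : ℕ → ℕ → GaloisField 2 8 := fun a b =>
    if h : b ≤ a ∧ a - b < 10 then c ⟨a - b, h.2⟩ else 0 with hM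
  have hentry (i : ℕ) (hi : i ≤ 254) := GF256.ofByte_expByte_of_le hω i hi
  have hrep : GF256.Rep 10 ω GF256.toeplitzRows 0 0 M := by
    have e1 : GF256.ofByte ω 1 = 1 := GF256.ofByte_one
    have e2 : GF256.ofByte ω 2 = ω := (hentry 1 (by norm_num)).trans (pow_one ω)
    have e8 : GF256.ofByte ω 8 = ω ^ 3 := hentry 3 (by norm_num)
    have e32 : GF256.ofByte ω 32 = ω ^ 5 := hentry 5 (by norm_num)
    have e116 : GF256.ofByte ω 116 = ω ^ 10 := hentry 10 (by norm_num)
    have e37 : GF256.ofByte ω 37 = ω ^ 36 := hentry 36 (by norm_num)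
    have e177 : GF256.ofByte ω 177 = ω ^ 86 := hentry 86 (by norm_num)
    have e187 : GF256.ofByte ω 187 = ω ^ 83 := hentry 83 (by norm_num)
    simp [GF256.Rep, GF256.RowRep, GF256.toeplitzRows, hM, hc, e1, e2, e8, e32, e116, e37, e177,
      e187, GF256.ofByte_zero]
  have key := GF256.check_sound (GF256.byteArith hω) 11 _ 0 0 M hrep GF256.check_toeplitzRows r
    (fun t => row t) (fun t => col t) mrow mcol (fun t => ⟨Nat.zero_le _, (row t).2⟩)
    (fun t => ⟨Nat.zero_le _, (col t).2⟩) hd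
  have hsub : (LTT c).submatrix row col = Matrix.of fun s t => M (row s) (col t) := by
    ext s t
    have : (row s : ℕ) - col t < 10 := (Nat.sub_le _ _).trans_lt (row s).2
    by_cases h : col t ≤ row s <;> simp [LTT, hM, this, h]
  rw [hsub]
  exact key
end

section
/- Over GF(2^8) generated by a root ω of ω⁸ + ω⁴ + ω³ + ω² + 1, the two 6×6 lower triangular Toeplitz matrices with first columns [1, ω⁰, ω², ω⁵, ω⁰, ω^{15}]^T and [1, ω¹, ω⁰, ω⁴, ω⁹, ω^{30}]^T are jointly superregular, and their product is superregular. -/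
open Matrix

/-- The value at `ω` of the polynomial over `GF(2)` whose coefficients are the binary digits
of `n`. -/
def evalBits {F : Type*} [Field F] (ω : F) (n : ℕ) : F :=
  if n = 0 then 0 else (if n % 2 = 1 then 1 else 0) + ω * evalBits ω (n / 2)
termination_by n
decreasing_by omega

/-- The value at `ω` of the sum of monomials with exponents listed in `l`. -/
def evalExps {F : Type*} [Field F] (ω : F) (l : List ℕ) : F :=
  (l.map (ω ^ ·)).sum

/-- Carry-less product of `n` with the sum of monomials with exponents listed in `l`. -/
def monomialsMul : List ℕ → ℕ → ℕ
  | [], _ => 0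
  | e :: l, n => (n <<< e) ^^^ monomialsMul l n

/-- All ways to remove one entry from a list. -/
def picks : List ℕ → List (ℕ × List ℕ)
  | [] => []
  | a :: l => (a, l) :: (picks l).map fun p => (p.1, a :: p.2)

/-- Laplace expansion along the first row of the minor with the given rows and columns, in
characteristic two, as a binary-coded polynomial over `GF(2)`. -/
def codedDet (e : ℕ → ℕ → List ℕ) : List ℕ → List ℕ → ℕ
  | [], _ => 1
  | i :: R, C =>
    (picks C).foldr (fun p acc => monomialsMul (e i p.1) (codedDet e R p.2) ^^^ acc) 0

/-- One step of the reduction modulo `X ^ 8 + X ^ 4 + X ^ 3 + X ^ 2 + 1`. -/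
def reduceStep (n : ℕ) : ℕ :=
  (n % 256) ^^^ monomialsMul [0, 2, 3, 4] (n / 256)

/-- Whether at most `k - 1` reduction steps lead from `n` to a nonzero residue. -/
def reducesToNonzero : ℕ → ℕ → Bool
  | 0, _ => false
  | k + 1, n => if n < 256 then n != 0 else reducesToNonzero k (reduceStep n)

/-- Whether all coded minors with rows among the first `m` and columns among the first `n` are
nonzero, provided that the columns are bounded by the heights `h` of the rows. -/
def minorsCheck (e : ℕ → ℕ → List ℕ) (h : ℕ → ℕ) (m n : ℕ) : Bool :=
  (List.range m).sublists.all fun R => ((List.range n).sublistsLen R.length).all fun C =>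
    !((List.zipWith (fun i k => decide (k ≤ h i)) R C).all id) ||
      reducesToNonzero 100 (codedDet e R C)

/-- Coded entries of the lower triangular Toeplitz matrix with coded first column `c`. -/
def toeplitzCode (c : List (List ℕ)) (i k : ℕ) : List ℕ :=
  if k ≤ i then c.getD (i - k) [] else []

section evalBits

variable {F : Type*} [Field F]

theorem evalBits_zero (ω : F) : evalBits ω 0 = 0 := by
  rw [evalBits]; simp

theorem evalBits_rec (ω : F) (n : ℕ) :
    evalBits ω n = (if n % 2 = 1 then 1 else 0) + ω * evalBits ω (n / 2) := by
  by_cases h : n = 0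
  · subst h; simp [evalBits_zero]
  · rw [evalBits, if_neg h]

theorem evalBits_one (ω : F) : evalBits ω 1 = 1 := by
  rw [evalBits_rec]; simp [evalBits_zero]

theorem evalBits_two_mul (ω : F) (n : ℕ) : evalBits ω (2 * n) = ω * evalBits ω n := by
  rw [evalBits_rec]; simp

theorem evalBits_shiftLeft (ω : F) (n k : ℕ) :
    evalBits ω (n <<< k) = ω ^ k * evalBits ω n := by
  induction k with
  | zero => simp
  | succ k ih => rw [Nat.shiftLeft_succ, evalBits_two_mul, ih]; ring

variable [CharP F 2]

theorem evalBits_xor (ω : F) (a b : ℕ) :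
    evalBits ω (a ^^^ b) = evalBits ω a + evalBits ω b := by
  induction a using Nat.strong_induction_on generalizing b with
  | _ a ih =>
    by_cases ha : a = 0
    · subst ha; simp [evalBits_zero]
    · rw [evalBits_rec ω (a ^^^ b), evalBits_rec ω a, evalBits_rec ω b, Nat.xor_div_two,
        ih _ (by omega)]
      have h2 : (1 : F) + 1 = 0 := CharTwo.add_self_eq_zero 1
      simp only [Nat.xor_mod_two_eq_one]
      by_cases h1 : a % 2 = 1 <;> by_cases h3 : b % 2 = 1 <;> simp [h1, h3] <;> grind

theorem evalBits_monomialsMul (ω : F) (l : List ℕ) (n : ℕ) :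
    evalBits ω (monomialsMul l n) = evalExps ω l * evalBits ω n := by
  induction l with
  | nil => simp [monomialsMul, evalExps, evalBits_zero]
  | cons e l ih =>
    rw [monomialsMul, evalBits_xor, evalBits_shiftLeft, ih]
    simp [evalExps, add_mul]

theorem evalBits_reduceStep {ω : F} (hω : ω ^ 8 + ω ^ 4 + ω ^ 3 + ω ^ 2 + 1 = 0) (n : ℕ) :
    evalBits ω (reduceStep n) = evalBits ω n := by
  have hn : n = (n % 256) ^^^ ((n / 256) <<< 8) := by
    refine Nat.eq_of_testBit_eq fun i => ?_
    rw [show 256 = 2 ^ 8 from rfl, Nat.testBit_xor, Nat.testBit_mod_two_pow,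
      Nat.testBit_shiftLeft, Nat.testBit_div_two_pow]
    by_cases hi : i < 8
    · simp [hi, Nat.not_le.2 hi]
    · simp [hi, Nat.le_of_not_lt hi]
  have h8 : ω ^ 8 = 1 + ω ^ 2 + ω ^ 3 + ω ^ 4 := by
    have h2 : (2 : F) = 0 := CharTwo.two_eq_zero
    linear_combination hω - (ω ^ 4 + ω ^ 3 + ω ^ 2 + 1) * h2
  conv_rhs => rw [hn, evalBits_xor, evalBits_shiftLeft, h8]
  rw [reduceStep, evalBits_xor, evalBits_monomialsMul]
  simp only [evalExps, List.map_cons, List.map_nil, List.sum_cons, List.sum_nil]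
  ring

theorem evalBits_iterate_ne_zero {ω : F} (hω : ω ^ 8 + ω ^ 4 + ω ^ 3 + ω ^ 2 + 1 = 0) (k : ℕ) :
    evalBits ω ((fun n => reduceStep (n <<< 1))^[k] 1) ≠ 0 := by
  have h0 : ω ≠ 0 := by rintro rfl; simp at hω
  induction k with
  | zero => simp [evalBits_one]
  | succ k ih =>
    rw [Function.iterate_succ_apply', evalBits_reduceStep hω, evalBits_shiftLeft]
    exact mul_ne_zero (pow_ne_zero _ h0) ih

theorem exists_iterate_eq :
    ∀ n < 256, n ≠ 0 → n ∈ List.iterate (fun n => reduceStep (n <<< 1)) 1 255 := by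
  decide +kernel

theorem evalBits_ne_zero_of_reduces {ω : F} (hω : ω ^ 8 + ω ^ 4 + ω ^ 3 + ω ^ 2 + 1 = 0)
    {k n : ℕ} (h : reducesToNonzero k n = true) : evalBits ω n ≠ 0 := by
  induction k generalizing n with
  | zero => simp [reducesToNonzero] at h
  | succ k ih =>
    rw [reducesToNonzero] at h
    split_ifs at h with hn
    · obtain ⟨j, -, hj⟩ := List.mem_iterate.1 (exists_iterate_eq n hn (by simpa using h))
      rw [hj]
      exact evalBits_iterate_ne_zero hω j
    · rw [← evalBits_reduceStep hω]
      exact ih h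

end evalBits

theorem picks_ofFn {r : ℕ} (f : Fin (r + 1) → ℕ) :
    picks (List.ofFn f) = List.ofFn fun j => (f j, List.ofFn fun t => f (j.succAbove t)) := by
  induction r with
  | zero => simp [picks]
  | succ r ih =>
    rw [List.ofFn_succ, picks, ih, List.map_ofFn,
      List.ofFn_succ (f := fun j => (f j, List.ofFn fun t => f (j.succAbove t)))]
    simp [List.ofFn_succ, Function.comp_def]

theorem LTT_apply_eq_evalExps {F : Type*} [Field F] (ω : F) {c : List (List ℕ)} {n : ℕ}
    {v : Fin n → F}
    (hv : ∀ i : Fin n, v i = evalExps ω (c.getD i [])) (j k : Fin n) :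
    LTT v j k = evalExps ω (toeplitzCode c j k) := by
  simp only [LTT, Matrix.of_apply, toeplitzCode]
  split_ifs
  · rw [hv]
  · simp [evalExps]

section minors

variable {F : Type*} [Field F] [CharP F 2]

theorem evalBits_foldr_xor {α : Type*} (ω : F) (f : α → ℕ) (l : List α) :
    evalBits ω (l.foldr (fun p acc => f p ^^^ acc) 0) = (l.map fun p => evalBits ω (f p)).sum := by
  induction l with
  | nil => simp [evalBits_zero]
  | cons a l ih => simp [evalBits_xor, ih]

theorem evalBits_codedDet (ω : F) (e : ℕ → ℕ → List ℕ) {r : ℕ} (row col : Fin r → ℕ) :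
    evalBits ω (codedDet e (List.ofFn row) (List.ofFn col)) =
      (Matrix.of fun t s => evalExps ω (e (row t) (col s))).det := by
  induction r with
  | zero => simp [codedDet, evalBits_one]
  | succ r ih =>
    rw [List.ofFn_succ (f := row), codedDet, picks_ofFn, evalBits_foldr_xor, List.map_ofFn,
      List.sum_ofFn, Matrix.det_succ_row_zero]
    refine Finset.sum_congr rfl fun j _ => ?_
    simp only [Function.comp_apply, evalBits_monomialsMul, ih, CharTwo.neg_eq, one_pow, one_mul]
    rfl

theorem det_ne_zero_of_minorsCheck {ω : F} (hω : ω ^ 8 + ω ^ 4 + ω ^ 3 + ω ^ 2 + 1 = 0)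
    {e : ℕ → ℕ → List ℕ} {h : ℕ → ℕ} {m n : ℕ} (hc : minorsCheck e h m n = true)
    {r : ℕ} {row col : Fin r → ℕ} (hrow : StrictMono row) (hcol : StrictMono col)
    (hm : ∀ t, row t < m) (hn : ∀ t, col t < n) (hle : ∀ t, col t ≤ h (row t)) :
    (Matrix.of fun t s => evalExps ω (e (row t) (col s))).det ≠ 0 := by
  have sub : ∀ {N : ℕ} {f : Fin r → ℕ}, StrictMono f → (∀ t, f t < N) →
      (List.ofFn f).Sublist (List.range N) := by
    intro N f hf hN
    refine List.sublist_of_subperm_of_sortedLE ?_ hf.monotone.sortedLE_ofFn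
      (List.sortedLT_range N).sortedLE
    refine (List.nodup_ofFn.2 hf.injective).subperm fun x hx => ?_
    obtain ⟨t, rfl⟩ := List.mem_ofFn.1 hx
    exact List.mem_range.2 (hN t)
  rw [← evalBits_codedDet]
  have key := List.all_eq_true.1 (List.all_eq_true.1 hc _ (List.mem_sublists.2 (sub hrow hm)))
    (List.ofFn col) (List.mem_sublistsLen.2 ⟨sub hcol hn, by simp⟩)
  refine evalBits_ne_zero_of_reduces hω (k := 100) ?_
  rw [Bool.or_eq_true] at key
  refine key.resolve_left ?_
  simp only [Bool.not_eq_true', Bool.not_eq_false, List.all_eq_true]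
  intro x hx
  obtain ⟨i, hi, rfl⟩ := List.mem_iff_getElem.1 hx
  simpa using hle _

theorem superregular_of_minorsCheck {ω : F} (hω : ω ^ 8 + ω ^ 4 + ω ^ 3 + ω ^ 2 + 1 = 0)
    {e : ℕ → ℕ → List ℕ} {n : ℕ} {A : Matrix (Fin n) (Fin n) F}
    (hA : ∀ j k : Fin n, A j k = evalExps ω (e j k)) (hc : minorsCheck e id n n = true) :
    Superregular A := by
  intro r row col hrow hcol hle
  have := det_ne_zero_of_minorsCheck hω hc (row := fun t => row t) (col := fun t => col t)
    hrow hcol (fun t => (row t).isLt) (fun t => (col t).isLt) hle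
  convert this using 2
  ext t s
  exact hA _ _

theorem jointlySuperregular_of_minorsCheck {ω : F}
    (hω : ω ^ 8 + ω ^ 4 + ω ^ 3 + ω ^ 2 + 1 = 0) {a b : ℕ → ℕ → List ℕ} {n : ℕ}
    {A B : Matrix (Fin n) (Fin n) F} (hA : ∀ j k : Fin n, A j k = evalExps ω (a j k))
    (hB : ∀ j k : Fin n, B j k = evalExps ω (b j k))
    (hc : minorsCheck (fun i k => if i % 2 = 0 then a (i / 2) k else b (i / 2) k) (· / 2)
      (2 * n) n = true) :
    JointlySuperregular A B := by
  intro r row tag col hrow hinj hcol hle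
  let g : Fin r → ℕ := fun t => 2 * row t + if tag t then 0 else 1
  have hdiv : ∀ t, g t / 2 = row t := fun t => by simp only [g]; split <;> omega
  have hmod : ∀ t, g t % 2 = 0 ↔ tag t = true := fun t => by
    simp only [g]; split <;> simp_all
  have hg : Function.Injective g := fun s t hst => hinj <| by
    have h1 : row s = row t := Fin.ext (by rw [← hdiv, ← hdiv, hst])
    have h2 : tag s = tag t := Bool.eq_iff_iff.2 (by rw [← hmod, ← hmod, hst])
    simp [h1, h2]
  let σ := Tuple.sort g
  have hσ : Monotone (g ∘ σ) := Tuple.monotone_sort g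
  have hrow' : row ∘ σ = row := by
    refine Tuple.unique_monotone (σ := σ) (τ := 1) (fun s t hst => ?_) hrow
    have := Nat.div_le_div_right (c := 2) (hσ hst)
    simp only [Function.comp_apply, hdiv] at this
    exact this
  have hrowσ : ∀ t, row (σ t) = row t := congrFun hrow'
  have key := det_ne_zero_of_minorsCheck hω hc (row := g ∘ σ) (col := fun t => col t)
    (hσ.strictMono_of_injective (hg.comp σ.injective)) hcol
    (fun t => by
      have := hdiv (σ t)
      have := (row (σ t)).isLt
      simp only [Function.comp_apply]
      omega)
    (fun t => (col t).isLt)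
    (fun t => by simpa only [Function.comp_apply, hdiv, hrowσ, Fin.le_def] using hle t)
  intro h0
  apply key
  have hperm := Matrix.det_permute σ
    (Matrix.of fun t s => (if tag t then A else B) (row t) (col s))
  rw [h0, mul_zero] at hperm
  rw [← hperm]
  congr 1
  ext t s
  simp only [Matrix.of_apply, Matrix.submatrix_apply, Function.comp_apply, hdiv, hmod, id]
  split_ifs
  · rw [hA]
  · rw [hB]

end minors

theorem stmt17 (ω : GaloisField 2 8) (hω : ω ^ 8 + ω ^ 4 + ω ^ 3 + ω ^ 2 + 1 = 0) :
    JointlySuperregular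
      (LTT ![(1 : GaloisField 2 8), ω ^ 0, ω ^ 2, ω ^ 5, ω ^ 0, ω ^ 15])
      (LTT ![(1 : GaloisField 2 8), ω ^ 1, ω ^ 0, ω ^ 4, ω ^ 9, ω ^ 30]) ∧
    Superregular
      (LTT ![(1 : GaloisField 2 8), ω ^ 0, ω ^ 2, ω ^ 5, ω ^ 0, ω ^ 15] *
       LTT ![(1 : GaloisField 2 8), ω ^ 1, ω ^ 0, ω ^ 4, ω ^ 9, ω ^ 30]) := by
  have hA := LTT_apply_eq_evalExps ω (c := [[0], [0], [2], [5], [0], [15]])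
    (v := ![1, ω ^ 0, ω ^ 2, ω ^ 5, ω ^ 0, ω ^ 15])
    (fun i => by fin_cases i <;> simp [evalExps])
  have hB := LTT_apply_eq_evalExps ω (c := [[0], [1], [0], [4], [9], [30]])
    (v := ![1, ω ^ 1, ω ^ 0, ω ^ 4, ω ^ 9, ω ^ 30])
    (fun i => by fin_cases i <;> simp [evalExps])
  refine ⟨jointlySuperregular_of_minorsCheck hω hA hB (by decide +kernel),
    superregular_of_minorsCheck hω (e := toeplitzCode
      [[0], [0, 1], [2, 1, 0], [5, 3, 0, 4], [0, 6, 2, 4, 9], [15, 1, 5, 6, 9, 30]])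
      (fun j k => ?_) (by decide +kernel)⟩
  rw [Matrix.mul_apply]
  simp only [hA, hB, Fin.sum_univ_six]
  fin_cases j <;> fin_cases k <;> simp [toeplitzCode, evalExps] <;> ring
end
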